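/- arXiv:2005.12363 — 2 statements merged into one kernel-verified Lean document; each statement's English description precedes it below -/
import Mathlib

section
/- Let w be a complex number with Re(w) > −1 and let z be a complex number that is not an integer. Then Σ_{k=0}^{∞} binom(w, k) · cos(πz − πk)/(πz − πk) = binom(w, z) · cot(πz), and the series converges absolutely. -/
open scoped Real

/-- The generalized binomial coefficient `binom w z = Γ(w+1) / (Γ(z+1) Γ(w-z+1))`. -/
noncomputable def cbinom (w z : ℂ) : ℂ :=
  Complex.Gamma (w + 1) / (Complex.Gamma (z + 1) * Complex.Gamma (w - z + 1))

theorem succ_mul_choose_succ (w : ℂ) (k : ℕ) :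
    (k + 1) * Ring.choose w (k + 1) = (w - k) * Ring.choose w k := by
  rw [Ring.choose_eq_smul, Ring.choose_eq_smul, descPochhammer_succ_right, Polynomial.smeval_mul,
    Nat.factorial_succ]
  have h1 : (k + 1 : ℂ) ≠ 0 := by exact_mod_cast k.succ_ne_zero
  have h2 : (k.factorial : ℂ) ≠ 0 := by exact_mod_cast k.factorial_ne_zero
  simp [Polynomial.smeval_sub, Polynomial.smeval_natCast]
  field_simp

theorem neg_one_pow_mul_choose_mul_factorial (w : ℂ) (n : ℕ) :
    (-1) ^ n * Ring.choose w n * (n.factorial : ℂ) = ∏ j ∈ Finset.range n, (-w + j) := by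
  induction n with
  | zero => simp
  | succ n ih =>
    rw [Finset.prod_range_succ, ← ih, Nat.factorial_succ]
    push_cast
    linear_combination (-1) ^ (n+1) * (n.factorial : ℂ) * succ_mul_choose_succ w n

theorem cbinom_natCast {w : ℂ} (hw : -1 < w.re) (k : ℕ) : cbinom w k = Ring.choose w k := by
  have hG : Complex.Gamma (w + 1) ≠ 0 := by
    apply Complex.Gamma_ne_zero_of_re_pos
    simp; linarith
  induction k with
  | zero => simp [cbinom, hG]
  | succ k ih =>
    have h1 : (k + 1 : ℂ) ≠ 0 := by exact_mod_cast k.succ_ne_zero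
    apply mul_left_cancel₀ h1
    rw [succ_mul_choose_succ, ← ih, cbinom, cbinom]
    simp only [div_eq_mul_inv, mul_inv]
    rw [Complex.one_div_Gamma_eq_self_mul_one_div_Gamma_add_one (w - (k + 1 : ℕ) + 1)]
    push_cast
    rw [Complex.Gamma_add_one _ h1, mul_inv, show w - (k + 1) + 1 = w - (k : ℂ) by ring]
    field_simp

/-- The binomial coefficients `w choose n` are `O(n ^ (-re w - 1))`. -/
theorem choose_isBigO (w : ℂ) :
    (fun n : ℕ => Ring.choose w n) =O[Filter.atTop] fun n : ℕ => (n : ℝ) ^ (-w.re - 1) := by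
  by_cases hw : ∃ m : ℕ, w = m
  · obtain ⟨m, rfl⟩ := hw
    refine Filter.EventuallyEq.trans_isBigO ?_ (Asymptotics.isBigO_zero _ _)
    filter_upwards [Filter.eventually_gt_atTop m] with n hn
    rw [Ring.choose_natCast, Nat.choose_eq_zero_of_lt hn, Nat.cast_zero]
  push Not at hw
  have hG : Complex.Gamma (-w) ≠ 0 :=
    Complex.Gamma_ne_zero fun m h => hw m (neg_injective h)
  have hlim := ((Complex.GammaSeq_tendsto_Gamma (-w)).inv₀ hG).norm
  have hb := hlim.eventually (gt_mem_nhds (lt_add_one _))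
  refine Asymptotics.IsBigO.of_bound (2 * (‖(Complex.Gamma (-w))⁻¹‖ + 1)) ?_
  filter_upwards [hb, Filter.eventually_gt_atTop 0,
    (tendsto_natCast_atTop_atTop (R := ℝ)).eventually_ge_atTop (2 * ‖w‖)] with n hn hn0 hnw
  have hn0' : (0 : ℝ) < n := by exact_mod_cast hn0
  have hge : (n : ℝ) / 2 ≤ ‖-w + n‖ := by
    have := norm_sub_norm_le (n : ℂ) w
    rw [Complex.norm_natCast] at this
    rw [neg_add_eq_sub]
    linarith
  have hf : (n.factorial : ℂ) ≠ 0 := by exact_mod_cast n.factorial_ne_zero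
  have hkey : (Complex.GammaSeq (-w) n)⁻¹ * (n : ℂ) ^ (-w) =
      (-1) ^ n * Ring.choose w n * (-w + n) := by
    have h3 : (n : ℂ) ^ (-w) ≠ 0 := by
      simp [Complex.cpow_eq_zero_iff, hn0.ne']
    rw [Complex.GammaSeq, Finset.prod_range_succ, ← neg_one_pow_mul_choose_mul_factorial]
    field_simp
  have hnorm := congrArg norm hkey
  simp only [norm_mul, norm_pow, norm_neg, norm_one, one_pow, one_mul,
    Complex.norm_natCast_cpow_of_pos hn0, Complex.neg_re] at hnorm
  rw [Real.norm_of_nonneg (by positivity), Real.rpow_sub_one hn0'.ne']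
  have hp : 0 < (n : ℝ) ^ (-w.re) := by positivity
  have : ‖Ring.choose w n‖ * ((n : ℝ) / 2) ≤ (‖(Complex.Gamma (-w))⁻¹‖ + 1) * (n : ℝ) ^ (-w.re) :=
    calc _ ≤ _ := mul_le_mul_of_nonneg_left hge (norm_nonneg _)
      _ = _ := hnorm.symm
      _ ≤ _ := mul_le_mul_of_nonneg_right hn.le hp.le
  calc _ = ‖Ring.choose w n‖ * ((n : ℝ) / 2) * (2 / n) := by field_simp
    _ ≤ (‖(Complex.Gamma (-w))⁻¹‖ + 1) * (n : ℝ) ^ (-w.re) * (2 / n) := by gcongr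
    _ = _ := by ring

theorem choose_tendsto_zero {w : ℂ} (hw : -1 < w.re) :
    Filter.Tendsto (fun n : ℕ => Ring.choose w n) Filter.atTop (nhds 0) := by
  refine (choose_isBigO w).trans_tendsto ?_
  have := (tendsto_rpow_neg_atTop (show 0 < w.re + 1 by linarith)).comp
    (tendsto_natCast_atTop_atTop (R := ℝ))
  simpa only [Function.comp_def, neg_add'] using this

theorem natCast_add_inv_isBigO (s : ℂ) :
    (fun n : ℕ => ((n : ℂ) + s)⁻¹) =O[Filter.atTop] fun n : ℕ => (n : ℝ) ^ (-1 : ℝ) := by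
  refine Asymptotics.IsBigO.of_bound 2 ?_
  filter_upwards [Filter.eventually_gt_atTop 0,
    (tendsto_natCast_atTop_atTop (R := ℝ)).eventually_ge_atTop (2 * ‖s‖)] with n hn0 hns
  have hn0' : (0 : ℝ) < n := by exact_mod_cast hn0
  have hge : (n : ℝ) / 2 ≤ ‖(n : ℂ) + s‖ := by
    have := norm_sub_norm_le (n : ℂ) (-s)
    rw [Complex.norm_natCast, norm_neg, sub_neg_eq_add] at this
    linarith
  rw [Real.norm_of_nonneg (by positivity), Real.rpow_neg_one, norm_inv]
  calc _ ≤ ((n : ℝ) / 2)⁻¹ := inv_anti₀ (by positivity) hge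
    _ = _ := by field_simp

theorem summable_norm_choose_div {w : ℂ} (hw : -1 < w.re) (s : ℂ) :
    Summable fun k : ℕ => ‖(-1) ^ k * Ring.choose w k / (k + s)‖ := by
  have h := ((choose_isBigO w).mul (natCast_add_inv_isBigO s)).norm_left
  refine summable_of_isBigO_nat (Real.summable_nat_rpow.2 (show -w.re - 2 < -1 by linarith)) ?_
  refine h.congr' ?_ ?_
  · filter_upwards with n
    simp [div_eq_mul_inv]
  · filter_upwards [Filter.eventually_gt_atTop 0] with n hn
    have hn' : (0 : ℝ) < n := by exact_mod_cast hn
    rw [← Real.rpow_add hn']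
    ring_nf
theorem hasSum_neg_one_pow_mul_choose_mul_pow (w : ℂ) {x : ℂ} (hx : ‖x‖ < 1) :
    HasSum (fun k : ℕ => (-1) ^ k * Ring.choose w k * x ^ k) ((1 - x) ^ w) := by
  have h := (Complex.one_add_cpow_hasFPowerSeriesOnBall_zero (a := w)).hasSum (y := -x)
    (by rw [← ENNReal.ofReal_one, Metric.eball_ofReal]; simpa using hx)
  rw [zero_add, ← sub_eq_add_neg] at h
  convert! h using 2 with k
  rw [binomialSeries_apply, List.ofFn_const, List.prod_replicate, neg_pow x, smul_eq_mul]
  ring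

/-- Termwise integration of the binomial expansion of `(1 - x) ^ w` in the beta integral. -/
theorem hasSum_betaIntegral {w s : ℂ} (hw : -1 < w.re) (hs : 0 < s.re) :
    HasSum (fun k : ℕ => (-1) ^ k * Ring.choose w k / (k + s)) (Complex.betaIntegral s (w + 1)) := by
  set a : ℕ → ℂ := fun k => (-1) ^ k * Ring.choose w k with ha
  have hre (k : ℕ) : -1 < (s + k - 1).re := by
    have : (0 : ℝ) ≤ k := k.cast_nonneg
    simp only [Complex.sub_re, Complex.add_re, Complex.natCast_re, Complex.one_re]
    linarith
  have hne (k : ℕ) : (k + s : ℂ) ≠ 0 := fun h => by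
    have := hre k
    rw [add_comm, h] at this
    simp at this
  have hInt (k : ℕ) : MeasureTheory.IntegrableOn (fun x : ℝ => a k * (x : ℂ) ^ (s + k - 1))
      (Set.Ioo 0 1) := by
    have := intervalIntegral.intervalIntegrable_cpow' (a := 0) (b := 1) (hre k)
    rw [intervalIntegrable_iff_integrableOn_Ioo_of_le zero_le_one] at this
    exact this.const_mul (a k)
  have hval (k : ℕ) : ∫ x in Set.Ioo (0 : ℝ) 1, a k * (x : ℂ) ^ (s + k - 1) = a k / (k + s) := by
    rw [MeasureTheory.integral_const_mul, ← MeasureTheory.integral_Ioc_eq_integral_Ioo,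
      ← intervalIntegral.integral_of_le zero_le_one, integral_cpow (.inl (hre k))]
    have : s + k - 1 + 1 = k + s := by ring
    rw [this, Complex.ofReal_zero, Complex.zero_cpow (hne k)]
    simp [div_eq_mul_inv]
  have hnorm (k : ℕ) : ∫ x in Set.Ioo (0 : ℝ) 1, ‖a k * (x : ℂ) ^ (s + k - 1)‖ =
      ‖a k / (k + (s.re : ℂ))‖ := by
    have h1 : ∫ x in Set.Ioo (0 : ℝ) 1, ‖a k * (x : ℂ) ^ (s + k - 1)‖ =
        ∫ x in Set.Ioo (0 : ℝ) 1, ‖a k‖ * x ^ (s + k - 1).re := by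
      refine MeasureTheory.setIntegral_congr_fun measurableSet_Ioo fun x hx => ?_
      simp only [norm_mul, Complex.norm_cpow_eq_rpow_re_of_pos hx.1]
    have hpos : 0 < k + s.re := by positivity
    have h2 : (s + k - 1).re + 1 = k + s.re := by simp; ring
    rw [h1, MeasureTheory.integral_const_mul, ← MeasureTheory.integral_Ioc_eq_integral_Ioo,
      ← intervalIntegral.integral_of_le zero_le_one, integral_rpow (.inl (hre k)), h2,
      Real.zero_rpow hpos.ne', Real.one_rpow, norm_div, ← Complex.ofReal_natCast,
      ← Complex.ofReal_add, Complex.norm_of_nonneg hpos.le]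
    ring
  have h := MeasureTheory.hasSum_integral_of_summable_integral_norm hInt
    (by simpa only [hnorm] using summable_norm_choose_div hw s.re)
  simp only [hval] at h
  convert! h using 1
  rw [Complex.betaIntegral, intervalIntegral.integral_of_le zero_le_one,
    MeasureTheory.integral_Ioc_eq_integral_Ioo]
  refine MeasureTheory.setIntegral_congr_fun measurableSet_Ioo fun x hx => ?_
  have hx0 : (x : ℂ) ≠ 0 := by exact_mod_cast hx.1.ne'
  have hx1 : ‖(x : ℂ)‖ < 1 := by
    rw [Complex.norm_of_nonneg hx.1.le]
    exact hx.2
  have hsum := (hasSum_neg_one_pow_mul_choose_mul_pow w hx1).mul_left ((x : ℂ) ^ (s - 1))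
  simp only [add_sub_cancel_right]
  rw [← hsum.tsum_eq]
  refine tsum_congr fun k => ?_
  rw [show s + k - 1 = (s - 1) + k by ring, Complex.cpow_add _ _ hx0, Complex.cpow_natCast]
  ring

/-- The functional equation of `s ↦ ∑ (-1) ^ k * (w choose k) / (k + s)`, by telescoping. -/
theorem mul_tsum_choose_div {w s : ℂ} (hw : -1 < w.re) (hs : ∀ k : ℕ, (k + s : ℂ) ≠ 0) :
    s * ∑' k : ℕ, (-1) ^ k * Ring.choose w k / (k + s) =
      (s + w + 1) * ∑' k : ℕ, (-1) ^ k * Ring.choose w k / (k + (s + 1)) := by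
  have hS := (summable_norm_choose_div hw s).of_norm
  have hT := (summable_norm_choose_div hw (s + 1)).of_norm
  set b : ℕ → ℂ := fun k => (-1) ^ k * Ring.choose w k * k / (k + s) with hb
  have hb0 : Filter.Tendsto b Filter.atTop (nhds 0) := by
    have h1 : Filter.Tendsto (fun n : ℕ => (-1) ^ n * Ring.choose w n) Filter.atTop (nhds 0) := by
      rw [tendsto_zero_iff_norm_tendsto_zero]
      simpa using (choose_tendsto_zero hw).norm
    have h2 := h1.sub (hS.tendsto_atTop_zero.const_mul s)
    rw [mul_zero, sub_zero] at h2
    refine h2.congr fun n => ?_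
    have := hs n
    simp only [hb]
    field_simp
    ring
  have hlim := ((hS.hasSum.mul_left s).sub (hT.hasSum.mul_left (s + w + 1))).tendsto_sum_nat
  have htel (k : ℕ) : s * ((-1) ^ k * Ring.choose w k / (k + s)) -
      (s + w + 1) * ((-1) ^ k * Ring.choose w k / (k + (s + 1))) = b (k + 1) - b k := by
    have h1 := hs k
    have h2 := hs (k + 1)
    have h3 : (k + (s + 1) : ℂ) ≠ 0 := by
      push_cast at h2
      rwa [add_assoc, add_comm 1 s] at h2
    have h4 : b (k + 1) = -(-1) ^ k * ((w - k) * Ring.choose w k) / (k + (s + 1)) := by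
      simp only [hb]
      rw [← succ_mul_choose_succ]
      push_cast
      rw [show (k : ℂ) + 1 + s = k + (s + 1) by ring]
      ring
    rw [h4]
    simp only [hb]
    field_simp
    ring
  simp only [htel, Finset.sum_range_sub] at hlim
  have h0 : b 0 = 0 := by simp [hb]
  simp only [h0, sub_zero] at hlim
  exact sub_eq_zero.1 (tendsto_nhds_unique hlim hb0)

/-- The partial fraction expansion of the beta function `B(s, w + 1)`. -/
theorem tsum_choose_div {w : ℂ} (hw : -1 < w.re) (n : ℕ) (s : ℂ) (hn : 0 < (s + n).re)
    (hs : ∀ k : ℕ, (k + s : ℂ) ≠ 0) :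
    ∑' k : ℕ, (-1) ^ k * Ring.choose w k / (k + s) =
      Complex.Gamma s * Complex.Gamma (w + 1) / Complex.Gamma (s + w + 1) := by
  have hw' : 0 < (w + 1).re := by simp; linarith
  induction n generalizing s with
  | zero =>
    rw [Nat.cast_zero, add_zero] at hn
    rw [(hasSum_betaIntegral hw hn).tsum_eq, Complex.Gamma_mul_Gamma_eq_betaIntegral hn hw',
      add_assoc, mul_div_cancel_left₀]
    apply Complex.Gamma_ne_zero_of_re_pos
    rw [Complex.add_re]
    positivity
  | succ n ih =>
    have hs0 : s ≠ 0 := by simpa using hs 0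
    have h := ih (s + 1) (by rw [add_assoc, add_comm 1]; exact_mod_cast hn) fun k => by
      have := hs (k + 1)
      push_cast at this
      rwa [add_assoc, add_comm 1] at this
    apply mul_left_cancel₀ hs0
    rw [mul_tsum_choose_div hw hs, h, Complex.Gamma_add_one s hs0]
    simp only [div_eq_mul_inv]
    rw [Complex.one_div_Gamma_eq_self_mul_one_div_Gamma_add_one (s + w + 1),
      show s + 1 + w + 1 = s + w + 1 + 1 by ring]
    ring

theorem cbinom_mul_pi_div_sin (w : ℂ) {z : ℂ} (hz : ∀ n : ℤ, z ≠ n) :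
    cbinom w z * (π / Complex.sin (π * z)) =
      -(Complex.Gamma (-z) * Complex.Gamma (w + 1) / Complex.Gamma (-z + w + 1)) := by
  have hz0 : z ≠ 0 := by exact_mod_cast hz 0
  have hG : Complex.Gamma z ≠ 0 := Complex.Gamma_ne_zero fun m => by exact_mod_cast hz (-m)
  rw [← Complex.Gamma_mul_Gamma_one_sub, cbinom, Complex.Gamma_add_one z hz0, sub_eq_neg_add 1 z,
    Complex.Gamma_add_one (-z) (neg_ne_zero.2 hz0), sub_eq_neg_add w z]
  simp only [div_eq_mul_inv, mul_inv]
  field_simp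

theorem series_binom_cos_eq_binom_cot (w : ℂ) (hw : -1 < w.re) (z : ℂ)
    (hz : ∀ n : ℤ, z ≠ (n : ℂ)) :
    HasSum (fun k : ℕ => cbinom w (k : ℂ) * (Complex.cos (π * z - π * k) / (π * z - π * k)))
        (cbinom w z * Complex.cot (π * z)) ∧
      Summable (fun k : ℕ =>
        ‖cbinom w (k : ℂ) * (Complex.cos (π * z - π * k) / (π * z - π * k))‖) := by
  have hpi : (π : ℂ) ≠ 0 := by exact_mod_cast Real.pi_ne_zero
  have hne (k : ℕ) : (k + -z : ℂ) ≠ 0 := fun h => hz k (by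
    rw [← sub_eq_add_neg, sub_eq_zero] at h
    exact_mod_cast h.symm)
  have hterm (k : ℕ) : cbinom w k * (Complex.cos (π * z - π * k) / (π * z - π * k)) =
      -(Complex.cos (π * z) / π) * ((-1) ^ k * Ring.choose w k / (k + -z)) := by
    have hcos : Complex.cos (π * z - π * k) = (-1) ^ k * Complex.cos (π * z) := by
      rw [mul_comm (π : ℂ) k, Complex.cos_antiperiodic.sub_nat_mul_eq k]
    have hden : (π * z - π * k : ℂ) = -(π * (k + -z)) := by ring
    rw [cbinom_natCast hw, hcos, hden]
    have := hne k
    field_simp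
  have hsum := summable_norm_choose_div hw (-z)
  simp only [hterm]
  constructor
  · obtain ⟨n, hn⟩ := exists_nat_gt z.re
    have h := hsum.of_norm.hasSum.mul_left (-(Complex.cos (π * z) / π))
    rw [tsum_choose_div hw n (-z) (by simpa using hn) hne] at h
    have hc := cbinom_mul_pi_div_sin w hz
    have hval : cbinom w z * Complex.cot (π * z) = -(Complex.cos (π * z) / π) *
        (Complex.Gamma (-z) * Complex.Gamma (w + 1) / Complex.Gamma (-z + w + 1)) := by
      rw [neg_mul, ← mul_neg, ← hc, Complex.cot_eq_cos_div_sin]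
      field_simp
    rwa [hval]
  · simp only [norm_mul _ (_ / _)]
    exact hsum.mul_left _
end

section
/- Let w be a complex number with Re(w) > −1 and let z be a complex number that is not an integer. Then Σ_{k=0}^{∞} binom(w, k) · (−1)^k / (z − k) = (π / sin(πz)) · binom(w, z). -/
open scoped Real

open Filter Topology Asymptotics MeasureTheory Set

theorem Gamma_add_one_ne_zero_of_neg_one_lt_re {w : ℂ} (hw : -1 < w.re) :
    Complex.Gamma (w + 1) ≠ 0 :=
  Complex.Gamma_ne_zero_of_re_pos (by simp; linarith)

theorem cbinom_zero {w : ℂ} (hw : -1 < w.re) : cbinom w 0 = 1 := by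
  simp [cbinom, Gamma_add_one_ne_zero_of_neg_one_lt_re hw]

theorem add_one_mul_cbinom_succ (w : ℂ) (k : ℕ) :
    ((k : ℂ) + 1) * cbinom w (k + 1 : ℕ) = (w - k) * cbinom w k := by
  have hk : (k : ℂ) + 1 ≠ 0 := by exact_mod_cast k.succ_ne_zero
  have h1 := Complex.Gamma_add_one ((k : ℂ) + 1) hk
  have h2 := Complex.one_div_Gamma_eq_self_mul_one_div_Gamma_add_one (w - k)
  have h3 : w - ((k : ℂ) + 1) + 1 = w - k := by ring
  simp only [cbinom, Nat.cast_add, Nat.cast_one, h1, h3]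
  rw [div_eq_mul_inv, div_eq_mul_inv, mul_inv, mul_inv, mul_inv]
  rw [h2]
  field_simp

/-- The ascending product `(-w)(-w+1)⋯(-w+k-1)` is `k!` times the alternating binomial. -/
theorem prod_range_neg_add {w : ℂ} (hw : -1 < w.re) (k : ℕ) :
    ∏ j ∈ Finset.range k, (-w + j) = cbinom w k * (-1) ^ k * k.factorial := by
  induction k with
  | zero => simp [cbinom_zero hw]
  | succ k ih =>
    rw [Finset.prod_range_succ, ih, Nat.factorial_succ, pow_succ]
    push_cast
    have h := add_one_mul_cbinom_succ w k
    push_cast at h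
    linear_combination (-1 : ℂ) ^ k * (k.factorial : ℂ) * h

theorem ringChoose_eq_cbinom {w : ℂ} (hw : -1 < w.re) (k : ℕ) :
    Ring.choose w k = cbinom w k := by
  have hsm : (descPochhammer ℤ k).smeval w = ∏ j ∈ Finset.range k, (w - j) := by
    rw [← Polynomial.aeval_eq_smeval, Polynomial.aeval_def, ← Polynomial.eval_map,
      descPochhammer_map, descPochhammer_eval_eq_prod_range]
  have hp : ∏ j ∈ Finset.range k, (w - j) = (-1) ^ k * ∏ j ∈ Finset.range k, (-w + j) := by
    have : ∀ j ∈ Finset.range k, w - j = -1 * (-w + j) := fun j _ => by ring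
    rw [Finset.prod_congr rfl this, Finset.prod_mul_distrib]
    simp
  have hk : (k.factorial : ℂ) ≠ 0 := by exact_mod_cast k.factorial_ne_zero
  have h1 : ((-1 : ℂ) ^ k) * (-1) ^ k = 1 := by rw [← mul_pow]; simp
  rw [Ring.choose_eq_smul, hsm, hp, prod_range_neg_add hw, smul_eq_mul, inv_mul_eq_iff_eq_mul₀ hk]
  linear_combination cbinom w k * k.factorial * h1

theorem inv_GammaSeq_isBigO_one (s : ℂ) :
    (fun n : ℕ => (Complex.GammaSeq s n)⁻¹) =O[atTop] (fun _ => (1 : ℝ)) := by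
  by_cases hs : Complex.Gamma s = 0
  · obtain ⟨m, rfl⟩ := (Complex.Gamma_eq_zero_iff s).1 hs
    refine (isBigO_zero _ _).congr' ?_ EventuallyEq.rfl
    filter_upwards [eventually_ge_atTop m] with n hn
    have : ∏ j ∈ Finset.range (n + 1), (-(m : ℂ) + j) = 0 :=
      Finset.prod_eq_zero (i := m) (by simp; omega) (by simp)
    simp [Complex.GammaSeq, this]
  · exact ((Complex.GammaSeq_tendsto_Gamma s).inv₀ hs).isBigO_one ℝ

theorem add_one_mul_cbinom_isBigO {w : ℂ} (hw : -1 < w.re) :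
    (fun n : ℕ => ((n : ℂ) + 1) * cbinom w (n + 1 : ℕ)) =O[atTop]
      (fun n : ℕ => (n : ℝ) ^ (-w.re)) := by
  have h : (fun n : ℕ => (n : ℂ) ^ (-w)) =O[atTop] (fun n : ℕ => (n : ℝ) ^ (-w.re)) := by
    refine IsBigO.of_bound 1 ?_
    filter_upwards [eventually_gt_atTop 0] with n hn
    rw [Complex.norm_natCast_cpow_of_pos hn, Complex.neg_re, one_mul]
    exact le_abs_self _
  refine IsBigO.of_norm_left (((h.mul (inv_GammaSeq_isBigO_one (-w))).norm_left).congr' ?_ ?_)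
  · filter_upwards [eventually_gt_atTop 0] with n hn
    have hn' : (n : ℂ) ≠ 0 := by exact_mod_cast hn.ne'
    have h1 : (n : ℂ) ^ (-w) ≠ 0 := by simp [Complex.cpow_eq_zero_iff, hn']
    have h2 : (n.factorial : ℂ) ≠ 0 := by exact_mod_cast n.factorial_ne_zero
    rw [Complex.GammaSeq, prod_range_neg_add hw, Nat.factorial_succ]
    have : (n : ℂ) ^ (-w) * ((n : ℂ) ^ (-w) * n.factorial /
        (cbinom w (n + 1 : ℕ) * (-1) ^ (n + 1) * ((n + 1) * n.factorial : ℕ)))⁻¹ =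
        ((n : ℂ) + 1) * cbinom w (n + 1 : ℕ) * (-1) ^ (n + 1) := by
      rw [inv_div]
      push_cast
      field_simp
    rw [this]
    simp
  · simp

theorem inv_add_natCast_isBigO (s : ℂ) :
    (fun n : ℕ => (s + (n + 1 : ℕ))⁻¹) =O[atTop] (fun n : ℕ => (n : ℝ) ^ (-1 : ℝ)) := by
  refine IsBigO.of_bound 2 ?_
  filter_upwards [eventually_gt_atTop 0, eventually_ge_atTop (⌈2 * ‖s‖⌉₊)] with n hn hn'
  have h1 : 2 * ‖s‖ ≤ n := Nat.ceil_le.1 hn'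
  have h0 : (0 : ℝ) < n := by exact_mod_cast hn
  have h2 : (n : ℝ) / 2 ≤ ‖s + (n + 1 : ℕ)‖ := by
    have := norm_sub_norm_le ((n + 1 : ℕ) : ℂ) (-s)
    rw [Complex.norm_natCast, norm_neg, sub_neg_eq_add, add_comm _ s] at this
    push_cast at this ⊢
    linarith
  rw [norm_inv, Real.rpow_neg_one, norm_inv, Real.norm_of_nonneg h0.le, ← div_eq_mul_inv,
    ← inv_div]
  exact inv_anti₀ (by positivity) h2

theorem summable_cbinom_div {w : ℂ} (hw : -1 < w.re) (s : ℂ) :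
    Summable (fun k : ℕ => cbinom w k * (-1) ^ k / (s + k)) := by
  rw [← summable_nat_add_iff 1]
  have hs : Summable (fun n : ℕ => (n : ℝ) ^ (-w.re - 2)) :=
    Real.summable_nat_rpow.2 (by linarith)
  refine summable_of_isBigO_nat hs ?_
  have h0 := inv_add_natCast_isBigO 0
  have h := ((add_one_mul_cbinom_isBigO hw).mul h0).mul (inv_add_natCast_isBigO s)
  refine IsBigO.of_norm_left (h.norm_left.congr' ?_ ?_)
  · filter_upwards with n
    have hk : (n : ℂ) + 1 ≠ 0 := by exact_mod_cast n.succ_ne_zero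
    push_cast
    rw [zero_add, mul_comm ((n : ℂ) + 1), mul_inv_cancel_right₀ hk]
    simp [div_eq_mul_inv]
  · filter_upwards [eventually_gt_atTop 0] with n hn
    have h0 : (0 : ℝ) < n := by exact_mod_cast hn
    rw [← Real.rpow_add h0, ← Real.rpow_add h0]
    congr 1; ring

theorem tendsto_natCast_mul_cbinom_div {w : ℂ} (hw : -1 < w.re) (s : ℂ) :
    Tendsto (fun k : ℕ => (k : ℂ) * (cbinom w k * (-1) ^ k) / (s + k)) atTop (𝓝 0) := by
  rw [← tendsto_add_atTop_iff_nat 1, tendsto_zero_iff_norm_tendsto_zero]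
  have h := (add_one_mul_cbinom_isBigO hw).mul (inv_add_natCast_isBigO s)
  have ht : Tendsto (fun n : ℕ => (n : ℝ) ^ (-(w.re + 1))) atTop (𝓝 0) :=
    (tendsto_rpow_neg_atTop (by linarith)).comp tendsto_natCast_atTop_atTop
  refine (((h.congr' EventuallyEq.rfl ?_).trans_tendsto ht).norm).congr' ?_ |>.trans (by simp)
  · filter_upwards [eventually_gt_atTop 0] with n hn
    have h0 : (0 : ℝ) < n := by exact_mod_cast hn
    rw [← Real.rpow_add h0]
    congr 1; ring
  · filter_upwards with n
    simp [div_eq_mul_inv]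

theorem mul_tsum_cbinom_div {w : ℂ} (hw : -1 < w.re) {s : ℂ} (hs : ∀ k : ℕ, s + k ≠ 0) :
    s * ∑' k : ℕ, cbinom w k * (-1) ^ k / (s + k) =
      (s + w + 1) * ∑' k : ℕ, cbinom w k * (-1) ^ k / (s + 1 + k) := by
  have h1 := (summable_cbinom_div hw s).hasSum.mul_left s
  have h2 := (summable_cbinom_div hw (s + 1)).hasSum.mul_left (s + w + 1)
  have h3 := (h1.sub h2).tendsto_sum_nat
  have h4 : ∀ n : ℕ, ∑ k ∈ Finset.range n, (s * (cbinom w k * (-1) ^ k / (s + k)) -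
      (s + w + 1) * (cbinom w k * (-1) ^ k / (s + 1 + k))) =
      (n : ℂ) * (cbinom w n * (-1) ^ n) / (s + n) := by
    intro n
    induction n with
    | zero => simp
    | succ n ih =>
      rw [Finset.sum_range_succ, ih]
      have e1 := hs n
      have e2 : s + 1 + n ≠ 0 := by
        have := hs (n + 1); push_cast at this; convert this using 1; ring
      have e3 : s + (n + 1 : ℕ) = s + 1 + n := by push_cast; ring
      have e4 : ((n + 1 : ℕ) : ℂ) * (cbinom w (n + 1 : ℕ) * (-1) ^ (n + 1)) =
          (n - w) * (cbinom w n * (-1) ^ n) := by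
        have := add_one_mul_cbinom_succ w n
        push_cast at this ⊢
        rw [pow_succ]
        linear_combination -(-1 : ℂ) ^ n * this
      rw [e4, e3]
      field_simp
      ring
  simp only [h4] at h3
  exact sub_eq_zero.1 (tendsto_nhds_unique h3 (tendsto_natCast_mul_cbinom_div hw s))

theorem hasSum_cbinom_mul_pow {w : ℂ} (hw : -1 < w.re) {t : ℝ} (ht : t ∈ Ioo (0 : ℝ) 1) :
    HasSum (fun k : ℕ => cbinom w k * (-1) ^ k * (t : ℂ) ^ k) ((1 - (t : ℂ)) ^ w) := by
  have h := (Complex.one_add_cpow_hasFPowerSeriesOnBall_zero (a := w)).hasSum (y := -(t : ℂ))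
    (by
    rw [Metric.mem_eball, edist_zero_right, enorm_neg, ← ofReal_norm, Complex.norm_real,
      Real.norm_of_nonneg ht.1.le]
    exact ENNReal.ofReal_lt_one.2 ht.2)
  rw [zero_add, ← sub_eq_add_neg] at h
  refine h.congr_fun fun k => ?_
  rw [binomialSeries_apply, ringChoose_eq_cbinom hw]
  simp [neg_pow (t : ℂ), mul_assoc]

theorem tsum_cbinom_div_of_re_pos {w : ℂ} (hw : -1 < w.re) {s : ℂ} (hs : 0 < s.re) :
    ∑' k : ℕ, cbinom w k * (-1) ^ k / (s + k) = Complex.betaIntegral s (w + 1) := by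
  have hre : ∀ k : ℕ, -1 < (s + k - 1).re := fun k => by
    have : (0 : ℝ) ≤ k := k.cast_nonneg
    simp; linarith
  have hre' : ∀ k : ℕ, -1 < s.re + k - 1 := fun k => by simpa using hre k
  let F : ℕ → ℝ → ℂ := fun k t => cbinom w k * (-1) ^ k * (t : ℂ) ^ (s + k - 1)
  have hF_int : ∀ k, IntegrableOn (F k) (Ioc 0 1) := fun k =>
    ((intervalIntegrable_iff_integrableOn_Ioc_of_le zero_le_one).1
      (intervalIntegral.intervalIntegrable_cpow' (hre k))).const_mul _
  have hF_val : ∀ k, ∫ t in Ioc (0 : ℝ) 1, F k t = cbinom w k * (-1) ^ k / (s + k) := by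
    intro k
    have h0 : s + k ≠ 0 := fun h => by
      have := congrArg Complex.re h
      have h1 := hre' k
      simp at this; linarith
    rw [← intervalIntegral.integral_of_le zero_le_one, intervalIntegral.integral_const_mul,
      integral_cpow (Or.inl (hre k))]
    simp [h0, div_eq_mul_inv]
  have hF_norm : ∀ k, ∫ t in Ioc (0 : ℝ) 1, ‖F k t‖ = ‖cbinom w k‖ / (s.re + k) := by
    intro k
    have : ∀ t ∈ Ioc (0 : ℝ) 1, ‖F k t‖ = ‖cbinom w k‖ * t ^ (s.re + k - 1) := by
      intro t ht
      simp [F, Complex.norm_cpow_eq_rpow_re_of_pos ht.1]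
    rw [setIntegral_congr_fun measurableSet_Ioc this,
      ← intervalIntegral.integral_of_le zero_le_one, intervalIntegral.integral_const_mul,
      integral_rpow (Or.inl (hre' k))]
    have h0 : s.re + k ≠ 0 := by have := hre' k; linarith
    simp [h0, div_eq_mul_inv]
  have hsum : Summable fun k => ∫ t in Ioc (0 : ℝ) 1, ‖F k t‖ := by
    simp_rw [hF_norm]
    refine (summable_cbinom_div hw (s.re : ℂ)).norm.congr fun k => ?_
    have h0 : 0 ≤ s.re + k := by have := k.cast_nonneg (α := ℝ); linarith
    rw [norm_div, ← Complex.ofReal_natCast, ← Complex.ofReal_add, Complex.norm_real,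
      Real.norm_of_nonneg h0]
    simp
  have h := (hasSum_integral_of_summable_integral_norm hF_int hsum).tsum_eq
  simp_rw [hF_val] at h
  rw [h, Complex.betaIntegral, intervalIntegral.integral_of_le zero_le_one,
    integral_Ioc_eq_integral_Ioo, integral_Ioc_eq_integral_Ioo]
  refine setIntegral_congr_fun measurableSet_Ioo fun t ht => ?_
  have ht0 : (t : ℂ) ≠ 0 := by exact_mod_cast ht.1.ne'
  have := (hasSum_cbinom_mul_pow hw ht).mul_left ((t : ℂ) ^ (s - 1))
  rw [add_sub_cancel_right, ← this.tsum_eq]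
  refine tsum_congr fun k => ?_
  have e : s + k - 1 = (s - 1) + k := by ring
  simp only [F]
  rw [e, Complex.cpow_add _ _ ht0, Complex.cpow_natCast]
  ring

theorem tsum_cbinom_div {w : ℂ} (hw : -1 < w.re) {s : ℂ} (hs : ∀ k : ℕ, s + k ≠ 0) :
    ∑' k : ℕ, cbinom w k * (-1) ^ k / (s + k) =
      Complex.Gamma s * Complex.Gamma (w + 1) / Complex.Gamma (s + (w + 1)) := by
  obtain ⟨n, hn⟩ := exists_nat_gt (-s.re)
  induction n generalizing s with
  | zero =>
    have h0 : 0 < s.re := by simpa using hn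
    rw [tsum_cbinom_div_of_re_pos hw h0,
      Complex.betaIntegral_eq_Gamma_mul_div _ _ h0 (by simp; linarith)]
  | succ n ih =>
    have hs0 : s ≠ 0 := by simpa using hs 0
    have hs1 : ∀ k : ℕ, s + 1 + k ≠ 0 := fun k => by
      have := hs (k + 1); push_cast at this; convert this using 1; ring
    have h := mul_tsum_cbinom_div hw hs
    rw [ih hs1 (by push_cast at hn; simp; linarith), Complex.Gamma_add_one s hs0] at h
    have h2 := Complex.one_div_Gamma_eq_self_mul_one_div_Gamma_add_one (s + (w + 1))
    have e : s + 1 + (w + 1) = s + (w + 1) + 1 := by ring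
    apply mul_left_cancel₀ hs0
    rw [h, e, div_eq_mul_inv, div_eq_mul_inv, h2]
    ring

theorem series_binom_alt_inv (w : ℂ) (hw : -1 < w.re) (z : ℂ)
    (hz : ∀ n : ℤ, z ≠ (n : ℂ)) :
    HasSum (fun k : ℕ => cbinom w (k : ℂ) * (-1) ^ k / (z - k))
      ((π : ℂ) / Complex.sin (π * z) * cbinom w z) := by
  have hs : ∀ k : ℕ, -z + k ≠ 0 := fun k h => hz k (by push_cast; linear_combination -h)
  have h := (summable_cbinom_div hw (-z)).hasSum.neg
  rw [tsum_cbinom_div hw hs] at h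
  have hG : Complex.Gamma (z + 1) ≠ 0 := Complex.Gamma_ne_zero fun m hm =>
    hz (-m - 1) (by push_cast; linear_combination hm)
  have hr := Complex.Gamma_mul_Gamma_one_sub (-z)
  rw [mul_neg, Complex.sin_neg, div_neg, sub_neg_eq_add, add_comm 1 z] at hr
  have e : -z + (w + 1) = w - z + 1 := by ring
  have hv : (π : ℂ) / Complex.sin (π * z) * cbinom w z =
      -(Complex.Gamma (-z) * Complex.Gamma (w + 1) / Complex.Gamma (-z + (w + 1))) := by
    rw [← neg_eq_iff_eq_neg.2 hr, cbinom, e]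
    field_simp
  rw [hv]
  refine h.congr_fun fun k => ?_
  rw [← div_neg]
  congr 1
  ring
end
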